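/- Let D ≥ 12 be an integer with D ≡ 0 or 1 (mod 4), and assume D ∉ {12, 16, 17, 20, 25, 28, 36, 73, 88, 97, 105, 112, 121, 124, 136, 145, 148, 169, 172, 184, 193, 196, 201, 217, 220, 241, 244, 265, 268, 292, 304, 316, 364, 385, 436, 484, 556, 604, 676, 796, 844, 1684}. Then S̃_D is nonempty and: if D ≡ 4 (mod 8), S̃_D has exactly three components, namely {e ∈ S̃_D : e ≡ 0 or 4 (mod 8)}, {e ∈ S̃_D : e ≡ 2 (mod 8)}, and {e ∈ S̃_D : e ≡ −2 (mod 8)}; if D ≡ 1 (mod 8), S̃_D has exactly two components, namely {e ∈ S̃_D : e ≡ 1 or 3 (mod 8)} and {e ∈ S̃_D : e ≡ −1 or −3 (mod 8)}; if D ≡ 0 (mod 8), S̃_D has exactly two components, namely {e ∈ S̃_D : e ≡ 0 or 4 (mod 8)} and {e ∈ S̃_D : e ≡ 2 or −2 (mod 8)}; otherwise (D ≡ 5 (mod 8)), S̃_D has exactly one component. -/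

import Mathlib

/-- The set `S̃_D = {e ∈ ℤ : e ≡ D (mod 2), e² < D and (e+4)² < D}`. -/
def SDt (D : ℤ) : Set ℤ := {e : ℤ | e % 2 = D % 2 ∧ e ^ 2 < D ∧ (e + 4) ^ 2 < D}

/-- The generating relation on `S̃_D`: `e ∼ -e-4q` whenever `q` is a positive integer
such that `-e-4q ∈ S̃_D` and `gcd(q, w) = 1` where `w = (D-e²)/4`. -/
def SMoveT (D : ℤ) (e e' : ℤ) : Prop :=
  e ∈ SDt D ∧ e' ∈ SDt D ∧
    ∃ q : ℤ, 0 < q ∧ e' = -e - 4 * q ∧ Int.gcd q ((D - e ^ 2) / 4) = 1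

/-- Two elements of `S̃_D` are linked when they lie in the same component. -/
abbrev Linked (D : ℤ) : ℤ → ℤ → Prop := Relation.EqvGen (SMoveT D)

theorem mem_SDt_iff {D r e : ℤ} (hr : 0 ≤ r) (h₁ : r ^ 2 < D) (h₂ : D ≤ (r + 1) ^ 2) :
    e ∈ SDt D ↔ e % 2 = D % 2 ∧ -r ≤ e ∧ e ≤ r - 4 := by
  have key : ∀ x : ℤ, x ^ 2 < D ↔ -r ≤ x ∧ x ≤ r := by
    intro x
    constructor
    · intro h
      have := abs_lt_of_sq_lt_sq (h.trans_le h₂) (by omega)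
      rw [abs_lt] at this
      omega
    · rintro ⟨h, h'⟩
      nlinarith
  simp only [SDt, Set.mem_ofPred_eq, key]
  omega

theorem reflect_mem {D e : ℤ} (he : e ∈ SDt D) : -4 - e ∈ SDt D := by
  obtain ⟨h₀, h₁, h₂⟩ := he
  refine ⟨by omega, ?_, ?_⟩
  · rw [show (-4 - e) ^ 2 = (e + 4) ^ 2 by ring]; exact h₂
  · rw [show (-4 - e + 4) ^ 2 = e ^ 2 by ring]; exact h₁

theorem linked_reflect {D e : ℤ} (he : e ∈ SDt D) : Linked D e (-4 - e) :=
  .rel _ _ ⟨he, reflect_mem he, 1, one_pos, by ring, by simp⟩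

theorem Linked.of_reflect {D e f : ℤ} (he : e ∈ SDt D) (hf : f ∈ SDt D)
    (h : Linked D (-4 - e) (-4 - f)) : Linked D e f :=
  ((linked_reflect he).trans _ _ _ h).trans _ _ _ ((linked_reflect hf).symm _ _)

theorem linked_add {D e q : ℤ} (he : e ∈ SDt D) (hf : e + 4 * (q - 1) ∈ SDt D) (hq : 0 < q)
    (hc : Int.gcd q ((D - e ^ 2) / 4) = 1) : Linked D e (e + 4 * (q - 1)) := by
  have h : -4 - (e + 4 * (q - 1)) = -e - 4 * q := by ring
  have hm := reflect_mem hf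
  refine Relation.EqvGen.trans _ _ _ (.rel _ _ ⟨he, hm, q, hq, h, hc⟩) ?_
  exact (linked_reflect hf).symm _ _

theorem four_dvd_sub_sq {D e : ℤ} (hD : D % 4 = 0 ∨ D % 4 = 1) (he : e % 2 = D % 2) :
    4 ∣ D - e ^ 2 := by
  obtain ⟨k, hk⟩ : ∃ k, e = 2 * k + D % 2 := ⟨e / 2, by omega⟩
  have h : e ^ 2 = 4 * (k ^ 2 + k * (D % 2)) + (D % 2) ^ 2 := by rw [hk]; ring
  rcases hD with hD | hD
  · rw [show D % 2 = 0 by omega] at h; omega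
  · rw [show D % 2 = 1 by omega] at h; omega

theorem linked_add_eight {D e : ℤ} (hD : D % 4 = 0 ∨ D % 4 = 1) (he : e ∈ SDt D)
    (hf : e + 8 ∈ SDt D) (h₃ : ¬ 3 ∣ D - e ^ 2) : Linked D e (e + 8) := by
  refine linked_add (q := 3) he hf (by norm_num) ?_
  rw [← Int.isCoprime_iff_gcd_eq_one, Int.prime_three.coprime_iff_not_dvd]
  have := four_dvd_sub_sq hD he.1
  omega

theorem linked_add_four {D e : ℤ} (he : e ∈ SDt D)
    (hf : e + 4 ∈ SDt D) (h₈ : (D - e ^ 2) % 8 = 4) : Linked D e (e + 4) := by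
  refine linked_add (q := 2) he hf (by norm_num) ?_
  rw [← Int.isCoprime_iff_gcd_eq_one, Int.prime_two.coprime_iff_not_dvd]
  omega

theorem linked_add_eight_of_jump {D e q : ℤ} (he : e ∈ SDt D) (hf : e + 8 ∈ SDt D)
    (he' : e + 4 * (q - 1) ∈ SDt D) (hf' : e + 4 * (q - 1) + 8 ∈ SDt D) (hq : 0 < q)
    (hce : Int.gcd q ((D - e ^ 2) / 4) = 1) (hcf : Int.gcd q ((D - (e + 8) ^ 2) / 4) = 1)
    (h : Linked D (e + 4 * (q - 1)) (e + 4 * (q - 1) + 8)) : Linked D e (e + 8) := by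
  have h₁ := linked_add he he' hq hce
  rw [show e + 4 * (q - 1) + 8 = e + 8 + 4 * (q - 1) by ring] at h hf'
  have h₂ := linked_add hf hf' hq hcf
  exact (h₁.trans _ _ _ h).trans _ _ _ (h₂.symm _ _)

/-- Every pair `e, e + 8` of elements of `S̃_D` admits a common jump of small length
`q ≡ 5 (mod 6)`. -/
def HasJumps (D r : ℤ) : Prop :=
  ∀ e ∈ SDt D, e + 8 ∈ SDt D → ∃ q : ℤ, q % 6 = 5 ∧ 0 < q ∧ 6 * q ≤ r ∧
    Int.gcd q ((D - e ^ 2) / 4) = 1 ∧ Int.gcd q ((D - (e + 8) ^ 2) / 4) = 1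

theorem sq_emod_three (e : ℤ) : e ^ 2 % 3 = if e % 3 = 0 then 0 else 1 := by
  rcases (by omega : e % 3 = 0 ∨ e % 3 = 1 ∨ e % 3 = 2) with h | h | h <;>
    simp [pow_two, Int.mul_emod, h]

section Interval

variable {D r : ℤ} (hD : D % 4 = 0 ∨ D % 4 = 1) (hr : 0 ≤ r) (h₁ : r ^ 2 < D)
  (h₂ : D ≤ (r + 1) ^ 2)

include hD hr h₁ h₂

theorem linked_add_eight_of_hasJumps_aux (H : D % 3 = 2 ∨ HasJumps D r) {e : ℤ} (he : e ∈ SDt D)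
    (hf : e + 8 ∈ SDt D) (hle : e ≤ -6) : Linked D e (e + 8) := by
  have mem : ∀ x : ℤ, x ∈ SDt D ↔ _ := fun x => mem_SDt_iff (e := x) hr h₁ h₂
  by_cases hgood : 3 ∣ D - e ^ 2
  swap
  · exact linked_add_eight hD he hf hgood
  have hsq := sq_emod_three e
  rcases H with H | H
  · exfalso; split_ifs at hsq <;> omega
  -- A single upward jump repairs every break with enough room above it.
  have single : ∀ x : ℤ, x ∈ SDt D → x + 8 ∈ SDt D → 3 * x + 24 ≤ r ∨ x ≤ -6 →
      (D % 3 = 1 ∧ x % 3 = 2) ∨ (D % 3 = 0 ∧ x % 3 = 0) → Linked D x (x + 8) := by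
    intro x hx hx8 hroom hmod
    obtain ⟨q, hq6, hq0, hqr, hc, hc'⟩ := H x hx hx8
    have hx' := (mem _).1 hx
    have hy : x + 4 * (q - 1) ∈ SDt D := (mem _).2 (by omega)
    have hy8 : x + 4 * (q - 1) + 8 ∈ SDt D := (mem _).2 (by omega)
    refine linked_add_eight_of_jump hx hx8 hy hy8 hq0 hc hc' (linked_add_eight hD hy hy8 ?_)
    have := sq_emod_three (x + 4 * (q - 1))
    split_ifs at this <;> omega
  by_cases hup : (D % 3 = 1 ∧ e % 3 = 2) ∨ (D % 3 = 0 ∧ e % 3 = 0)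
  · exact single e he hf (Or.inr hle) hup
  have hm : D % 3 = 1 ∧ e % 3 = 1 := by split_ifs at hsq <;> omega
  have hrf : -4 - (e + 8) + 8 = -4 - e := by ring
  by_cases hdown : -12 - 3 * e ≤ r
  · refine .of_reflect he hf (.symm _ _ ?_)
    have := single (-4 - (e + 8)) (reflect_mem hf) (hrf ▸ reflect_mem he)
      (Or.inl (by omega)) (Or.inl (by omega))
    rwa [hrf] at this
  obtain ⟨q, hq6, hq0, hqr, hc, hc'⟩ := H e he hf
  have he' := (mem _).1 he
  have hy : e + 4 * (q - 1) ∈ SDt D := (mem _).2 (by omega)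
  have hy8 : e + 4 * (q - 1) + 8 ∈ SDt D := (mem _).2 (by omega)
  exact linked_add_eight_of_jump he hf hy hy8 hq0 hc hc'
    (single _ hy hy8 (by omega) (Or.inl (by omega)))

theorem linked_add_eight_of_hasJumps (H : D % 3 = 2 ∨ HasJumps D r) {e : ℤ} (he : e ∈ SDt D)
    (hf : e + 8 ∈ SDt D) : Linked D e (e + 8) := by
  by_cases hle : e ≤ -6
  · exact linked_add_eight_of_hasJumps_aux hD hr h₁ h₂ H he hf hle
  have hrf : -4 - (e + 8) + 8 = -4 - e := by ring
  have := linked_add_eight_of_hasJumps_aux hD hr h₁ h₂ H (reflect_mem hf)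
    (hrf ▸ reflect_mem he) (by omega)
  rw [hrf] at this
  exact .of_reflect he hf (this.symm _ _)

omit hD in
theorem linked_of_steps {d : ℤ} (hd : 0 < d) (hd2 : 2 ∣ d) {P : ℤ → Prop}
    (hP : ∀ e, P e → P (e + d))
    (step : ∀ e ∈ SDt D, e + d ∈ SDt D → P e → Linked D e (e + d)) {e f : ℤ}
    (he : e ∈ SDt D) (hf : f ∈ SDt D) (hPe : P e) (hPf : P f) (hef : d ∣ f - e) :
    Linked D e f := by
  have mem : ∀ x : ℤ, x ∈ SDt D ↔ _ := fun x => mem_SDt_iff (e := x) hr h₁ h₂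
  have main : ∀ n : ℕ, ∀ e ∈ SDt D, P e → e + d * n ∈ SDt D → Linked D e (e + d * n) := by
    intro n
    induction n with
    | zero => intro e he _ _; simpa using Relation.EqvGen.refl e
    | succ n ih =>
      intro e he hPe hf
      have hm : e + d ∈ SDt D := by
        rw [mem] at he hf ⊢
        push_cast at hf
        have : 0 ≤ d * n := by positivity
        refine ⟨by omega, by omega, ?_⟩
        have := hf.2.2
        rw [mul_add, mul_one] at this
        omega
      have heq : e + d * ((n + 1 : ℕ) : ℤ) = e + d + d * n := by push_cast; ring
      rw [heq] at hf ⊢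
      exact (step e he hm hPe).trans _ _ _ (ih _ hm (hP e hPe) hf)
  have up : ∀ e ∈ SDt D, ∀ f ∈ SDt D, P e → d ∣ f - e → e ≤ f → Linked D e f := by
    rintro e he f hf hPe ⟨k, hk⟩ hle
    have hk0 : 0 ≤ k := by
      by_contra hneg
      nlinarith
    lift k to ℕ using hk0
    obtain rfl : f = e + d * k := by omega
    exact main k e he hPe hf
  rcases le_total e f with hle | hle
  · exact up e he f hf hPe hef hle
  · exact (up f hf e he hPf ((dvd_sub_comm).1 hef) hle).symm _ _

end Interval

theorem hasJumps_of_nonresidue {D r : ℤ} {p m : ℕ} (hD : D % 4 = 0 ∨ D % 4 = 1)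
    (hp : p.Prime) (hpm : p = 2 * m + 1) (hp6 : p % 6 = 5) (hpr : 6 * (p : ℤ) ≤ r)
    (h : D ^ m % (p : ℤ) = p - 1) : HasJumps D r := by
  have := Fact.mk hp
  have hndvd : ∀ e : ℤ, e % 2 = D % 2 → Int.gcd p ((D - e ^ 2) / 4) = 1 := by
    intro e he
    rw [← Int.isCoprime_iff_gcd_eq_one, (Nat.prime_iff_prime_int.1 hp).coprime_iff_not_dvd]
    intro hdvd
    have hdvd' : (p : ℤ) ∣ D - e ^ 2 :=
      hdvd.trans ⟨4, (Int.ediv_mul_cancel (four_dvd_sub_sq hD he)).symm⟩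
    have h1 : (D : ZMod p) = (e : ZMod p) ^ 2 := by
      have := (ZMod.intCast_zmod_eq_zero_iff_dvd _ p).2 hdvd'
      push_cast at this
      exact sub_eq_zero.1 this
    have h2 : (D : ZMod p) ^ m = -1 := by
      have h3 : (p : ℤ) ∣ D ^ m + 1 := by
        have := Int.emod_add_mul_ediv (D ^ m) p
        exact ⟨D ^ m / p + 1, by rw [mul_add]; omega⟩
      have := (ZMod.intCast_zmod_eq_zero_iff_dvd _ p).2 h3
      push_cast at this
      exact eq_neg_of_add_eq_zero_left this
    rw [h1, ← pow_mul] at h2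
    have hm : 2 * m = p - 1 := by omega
    have hp2 : 2 < p := by omega
    have := Fact.mk hp2
    rw [hm] at h2
    by_cases he0 : (e : ZMod p) = 0
    · rw [he0, zero_pow (by omega)] at h2
      exact one_ne_zero (neg_eq_zero.1 h2.symm)
    · rw [ZMod.pow_card_sub_one_eq_one he0] at h2
      exact ZMod.neg_one_ne_one h2.symm
  intro e he hf
  exact ⟨p, by omega, by exact_mod_cast hp.pos, hpr, hndvd e he.1, hndvd (e + 8) hf.1⟩

/-- The factor `6k + 5` when it is a prime below `6400`, and `1` otherwise. -/
def primeFactorOrOne (k : ℕ) : ℕ :=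
  if ∀ d < 80, d < 2 ∨ 6 * k + 5 ≤ d ∨ ¬ d ∣ 6 * k + 5 then 6 * k + 5 else 1

def primeProd : ℕ → ℕ
  | 0 => 1
  | n + 1 => primeFactorOrOne n * primeProd n

theorem primeFactorOrOne_eq {k : ℕ} (hk : k ≤ 1000) :
    primeFactorOrOne k = 1 ∨ (primeFactorOrOne k = 6 * k + 5 ∧ (6 * k + 5).Prime) := by
  unfold primeFactorOrOne
  split_ifs with h
  · right
    refine ⟨rfl, ?_⟩
    by_contra hp
    have h1 := Nat.minFac_sq_le_self (by omega : 0 < 6 * k + 5) hp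
    have h2 : (6 * k + 5).minFac.Prime := Nat.minFac_prime (by omega)
    have h3 : (6 * k + 5).minFac < 80 := by nlinarith
    have h4 : (6 * k + 5).minFac ≠ 6 * k + 5 := fun h' => hp (h' ▸ h2)
    have h5 := Nat.minFac_le (by omega : 0 < 6 * k + 5)
    have h6 := h2.two_le
    rcases h _ h3 with h | h | h
    · omega
    · omega
    · exact h (Nat.minFac_dvd _)
  · exact Or.inl rfl

theorem primeProd_eq_prod (n : ℕ) : primeProd n = ∏ k ∈ Finset.range n, primeFactorOrOne k := by
  induction n with
  | zero => rfl
  | succ n ih => rw [primeProd, ih, Finset.prod_range_succ, mul_comm]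

theorem exists_coprime_of_lt_primeProd {n W : ℕ} (hn : n ≤ 1000) (hW : 0 < W)
    (h : W < primeProd n) : ∃ q, q % 6 = 5 ∧ q + 1 ≤ 6 * n ∧ q.Coprime W := by
  by_contra! hcon
  refine (Nat.le_of_dvd hW ?_).not_gt h
  rw [primeProd_eq_prod]
  apply Finset.prod_dvd_of_isRelPrime
  · intro i hi j hj hij
    simp only [Finset.coe_range, Set.mem_Iio] at hi hj
    rw [Function.onFun, ← Nat.coprime_iff_isRelPrime]
    rcases primeFactorOrOne_eq (hi.le.trans hn) with h1 | ⟨h1, hp⟩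
    · rw [h1]; exact Nat.coprime_one_left _
    rcases primeFactorOrOne_eq (hj.le.trans hn) with h2 | ⟨h2, hp'⟩
    · rw [h2]; exact Nat.coprime_one_right _
    rw [h1, h2, Nat.coprime_primes hp hp']
    omega
  · intro k hk
    rw [Finset.mem_range] at hk
    rcases primeFactorOrOne_eq (hk.le.trans hn) with h1 | ⟨h1, hp⟩
    · rw [h1]; exact one_dvd _
    · rw [h1]
      by_contra hnd
      exact hcon (6 * k + 5) (by omega) (by omega) ((Nat.Prime.coprime_iff_not_dvd hp).2 hnd)

open Finset in
/-- If `W < (N + 1) ^ N` then one of the numbers `N# * k - 1` with `1 ≤ k ≤ N` is prime to `W`. -/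
theorem exists_coprime_of_lt_pow {N W : ℕ} (hN : 3 ≤ N) (hW : 0 < W) (h : W < (N + 1) ^ N) :
    ∃ q, q % 6 = 5 ∧ q ≤ 4 ^ N * N ∧ q.Coprime W := by
  by_contra! hcon
  have hprim : ∀ p, p.Prime → p ≤ N → p ∣ primorial N := fun p hp hpN =>
    Finset.dvd_prod_of_mem _ (by simp [hp]; omega)
  have h6 : 6 ∣ primorial N :=
    Nat.Coprime.mul_dvd_of_dvd_of_dvd (by norm_num : Nat.Coprime 2 3)
      (hprim 2 Nat.prime_two (by omega)) (hprim 3 Nat.prime_three hN)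
  have hpos : 0 < primorial N := primorial_pos N
  have hex : ∀ k ∈ Finset.Icc 1 N, ∃ p, p.Prime ∧ p ∣ primorial N * k - 1 ∧ p ∣ W := by
    intro k hk
    rw [Finset.mem_Icc] at hk
    have hle : primorial N * k ≤ 4 ^ N * N := Nat.mul_le_mul (primorial_le_four_pow N) hk.2
    have h6k : 6 ∣ primorial N * k := h6.mul_right k
    have hpk : 0 < primorial N * k := Nat.mul_pos hpos hk.1
    exact Nat.Prime.not_coprime_iff_dvd.1 (hcon (primorial N * k - 1) (by omega) (by omega))
  choose! p hp hpk hpW using hex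
  have hbig : ∀ k ∈ Finset.Icc 1 N, N < p k := by
    intro k hk
    by_contra! hle
    have h1 := (hprim _ (hp k hk) hle).mul_right k
    have hpk0 : 0 < primorial N * k := Nat.mul_pos hpos (Finset.mem_Icc.1 hk).1
    have h2 := (Nat.dvd_sub h1 (hpk k hk))
    rw [Nat.sub_sub_self hpk0] at h2
    exact (hp k hk).one_lt.ne' (Nat.dvd_one.1 h2)
  have hlt : ∀ k ∈ Finset.Icc 1 N, ∀ l ∈ Finset.Icc 1 N, k < l → p k ≠ p l := by
    intro k hk l hl hkl heq
    have h1 := hpk k hk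
    have h2 := hpk l hl
    rw [← heq] at h2
    have h3 := Nat.dvd_sub h2 h1
    have hpk0 : 0 < primorial N * k := Nat.mul_pos hpos (Finset.mem_Icc.1 hk).1
    have h4 : primorial N * l - 1 - (primorial N * k - 1) = primorial N * (l - k) := by
      rw [Nat.mul_sub]; omega
    rw [h4] at h3
    have hcop : (p k).Coprime (primorial N) := by
      rw [(hp k hk).coprime_iff_not_dvd]
      intro hd
      have h2 := (Nat.dvd_sub (hd.mul_right k) h1)
      rw [Nat.sub_sub_self hpk0] at h2
      exact (hp k hk).one_lt.ne' (Nat.dvd_one.1 h2)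
    have h5 := Nat.le_of_dvd (by omega) (hcop.dvd_of_dvd_mul_left h3)
    have := hbig k hk
    rw [Finset.mem_Icc] at hk hl
    omega
  have hinj : Set.InjOn p (Finset.Icc 1 N) := by
    intro k hk l hl heq
    rcases lt_trichotomy k l with h' | h' | h'
    · exact absurd heq (hlt k hk l hl h')
    · exact h'
    · exact absurd heq.symm (hlt l hl k hk h')
  have hdvd : ∏ k ∈ Finset.Icc 1 N, p k ∣ W := by
    rw [← Finset.prod_image (f := fun q => q) hinj]
    apply Finset.prod_primes_dvd
    · rintro q hq
      obtain ⟨k, hk, rfl⟩ := Finset.mem_image.1 hq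
      exact (hp k hk).prime
    · rintro q hq
      obtain ⟨k, hk, rfl⟩ := Finset.mem_image.1 hq
      exact hpW k hk
  have hle : ∏ k ∈ Finset.Icc 1 N, (N + 1) ≤ ∏ k ∈ Finset.Icc 1 N, p k :=
    Finset.prod_le_prod' fun k hk => hbig k hk
  rw [Finset.prod_const, Nat.card_Icc, Nat.add_sub_cancel] at hle
  exact absurd (Nat.le_of_dvd hW hdvd) (by omega)

theorem pow_bound {m : ℕ} (hm : 512 ≤ m) : 81 * 256 ^ m * m ^ 5 < m ^ m := by
  obtain ⟨k, rfl⟩ : ∃ k, m = k + 5 := ⟨m - 5, by omega⟩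
  rw [pow_add (k + 5) k 5]
  refine Nat.mul_lt_mul_of_pos_right ?_ (by positivity)
  calc 81 * 256 ^ (k + 5) < 2 ^ 7 * 256 ^ (k + 5) := by gcongr; norm_num
    _ = 2 ^ (7 + 8 * (k + 5)) := by rw [pow_add 2 7, pow_mul]; norm_num
    _ ≤ 2 ^ (9 * k) := Nat.pow_le_pow_right (by norm_num) (by omega)
    _ = 512 ^ k := by rw [pow_mul]; norm_num
    _ ≤ (k + 5) ^ k := Nat.pow_le_pow_left hm k

theorem primeProd_large :
    ∃ M, 512 = M ∧ (36 * 16 ^ M * M ^ 2) ^ 2 ≤ 16 * primeProd 1000 := by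
  have h : ∃ M ∈ [512], (36 * 16 ^ M * M ^ 2) ^ 2 ≤ 16 * primeProd 1000 := by decide +kernel
  simpa only [List.mem_singleton, eq_comm] using h

theorem exists_small_coprime {D W : ℕ} (hD : 79524 < D) (hW : 0 < W) (hDW : 16 * W ≤ D ^ 2) :
    ∃ q, q % 6 = 5 ∧ (6 * q) ^ 2 < D ∧ q.Coprime W := by
  have rung : ∀ n B, n ≤ 1000 → (36 * n - 6) ^ 2 < D → D < B → B ^ 2 ≤ 16 * primeProd n →
      ∃ q, q % 6 = 5 ∧ (6 * q) ^ 2 < D ∧ q.Coprime W := by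
    intro n B hn hlo hhi hB
    have hlt : W < primeProd n := by
      have : D ^ 2 < B ^ 2 := Nat.pow_lt_pow_left hhi two_ne_zero
      omega
    obtain ⟨q, h1, h2, h3⟩ := exists_coprime_of_lt_primeProd hn hW hlt
    refine ⟨q, h1, lt_of_le_of_lt (Nat.pow_le_pow_left ?_ 2) hlo, h3⟩
    omega
  rcases lt_or_ge D 138000 with h | h
  · exact rung 8 138000 (by norm_num) (by omega) h (by decide +kernel)
  rcases lt_or_ge D 1000000 with h | h
  · exact rung 9 1000000 (by norm_num) (by omega) h (by decide +kernel)
  rcases lt_or_ge D (5 * 10 ^ 11) with h | hge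
  · exact rung 18 (5 * 10 ^ 11) (by norm_num) (by omega) h (by decide +kernel)
  have hmono : ∀ a b : ℕ, a < b → 36 * 16 ^ a * a ^ 2 < 36 * 16 ^ b * b ^ 2 := by
    intro a b hab
    gcongr
    norm_num
  obtain ⟨M, hM, hprod⟩ := primeProd_large
  rcases lt_or_ge D (36 * 16 ^ M * M ^ 2) with h | h
  · exact rung 1000 _ le_rfl (lt_of_lt_of_le (by norm_num) hge) h hprod
  have hex : ∃ m, D ≤ 36 * 16 ^ m * m ^ 2 := by
    refine ⟨D, ?_⟩
    calc D ≤ 16 ^ D := (Nat.lt_pow_self (by norm_num)).le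
      _ ≤ 36 * 16 ^ D * D ^ 2 := by
        rw [mul_comm 36, mul_assoc]
        exact Nat.le_mul_of_pos_right _ (by positivity)
  classical
  set m := Nat.find hex with hm
  have hfind : D ≤ 36 * 16 ^ m * m ^ 2 := Nat.find_spec hex
  have hm512 : 512 ≤ m := by
    by_contra! hlt
    rw [hM] at hlt
    have := hmono m M hlt
    omega
  obtain ⟨N, hN⟩ : ∃ N, m = N + 1 := ⟨m - 1, by omega⟩
  have hlow : 36 * 16 ^ N * N ^ 2 < D := not_le.1 (Nat.find_min hex (by omega))
  have hWlt : W < (N + 1) ^ N := by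
    have h1 := pow_bound hm512
    rw [hN] at h1 hfind
    have h2 : D ^ 2 ≤ (36 * 16 ^ (N + 1) * (N + 1) ^ 2) ^ 2 := Nat.pow_le_pow_left hfind 2
    have h3 : (36 * 16 ^ (N + 1) * (N + 1) ^ 2) ^ 2
        = 16 * (81 * 256 ^ (N + 1) * (N + 1) ^ 4) := by
      rw [show 256 = 16 ^ 2 by norm_num, ← pow_mul]; ring
    have h4 : 81 * 256 ^ (N + 1) * (N + 1) ^ 4 < (N + 1) ^ N := by
      have : (81 * 256 ^ (N + 1) * (N + 1) ^ 4) * (N + 1) < (N + 1) ^ N * (N + 1) := by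
        rw [← pow_succ]; calc
          _ = 81 * 256 ^ (N + 1) * (N + 1) ^ 5 := by ring
          _ < _ := h1
      exact Nat.lt_of_mul_lt_mul_right this
    omega
  obtain ⟨q, h1, h2, h3⟩ := exists_coprime_of_lt_pow (by omega) hW hWlt
  refine ⟨q, h1, lt_of_le_of_lt ?_ hlow, h3⟩
  calc (6 * q) ^ 2 ≤ (6 * (4 ^ N * N)) ^ 2 := by gcongr
    _ = 36 * 16 ^ N * N ^ 2 := by rw [show 16 = 4 ^ 2 by norm_num, ← pow_mul]; ring

theorem hasJumps_of_large {D r : ℤ} (hr : 0 ≤ r) (h₂ : D ≤ (r + 1) ^ 2)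
    (hD : D % 4 = 0 ∨ D % 4 = 1) (hlarge : 79524 < D) : HasJumps D r := by
  intro e he hf
  have pos : ∀ x ∈ SDt D, 0 < (D - x ^ 2) / 4 ∧ 4 * ((D - x ^ 2) / 4) ≤ D := by
    intro x hx
    have h1 := four_dvd_sub_sq hD hx.1
    have h2 := hx.2.1
    have h3 := sq_nonneg x
    omega
  obtain ⟨a0, a1⟩ := pos e he
  obtain ⟨b0, b1⟩ := pos _ hf
  set a := (D - e ^ 2) / 4
  set b := (D - (e + 8) ^ 2) / 4
  lift a to ℕ using a0.le with a'
  lift b to ℕ using b0.le with b'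
  lift D to ℕ using (by omega) with D'
  have hDW : 16 * (a' * b') ≤ D' ^ 2 := by
    have : 4 * a' ≤ D' := by exact_mod_cast a1
    have : 4 * b' ≤ D' := by exact_mod_cast b1
    nlinarith
  obtain ⟨q, hq6, hqD, hc⟩ := exists_small_coprime (D := D') (W := a' * b')
    (by exact_mod_cast hlarge) (Nat.mul_pos (by exact_mod_cast a0) (by exact_mod_cast b0)) hDW
  refine ⟨q, by omega, by omega, ?_, ?_, ?_⟩
  · have : (6 * (q : ℤ)) ^ 2 < (r + 1) ^ 2 := lt_of_lt_of_le (by exact_mod_cast hqD) h₂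
    have := abs_lt_of_sq_lt_sq this (by omega)
    rw [abs_lt] at this
    omega
  · rw [Int.gcd_natCast_natCast]; exact Nat.Coprime.coprime_mul_right_right hc
  · rw [Int.gcd_natCast_natCast]; exact Nat.Coprime.coprime_mul_left_right hc

/-- `D - e ^ 2` for `e = x - 512`. -/
def shiftedDisc (D x : ℕ) : ℕ :=
  Nat.sub (Nat.add D (Nat.mul 1024 x)) (Nat.add (Nat.mul x x) 262144)

/-- Whether `x` and `y` are joined by one move followed by a reflection, where `A` and `B` are the
values of `shiftedDisc` at `x` and at `x + 4`. -/
def nearBool (A B x y : ℕ) : Bool :=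
  cond (Nat.ble x y) (Nat.beq (Nat.gcd (Nat.succ (Nat.div (Nat.sub y x) 4)) A) 1)
    (Nat.beq (Nat.gcd (Nat.succ (Nat.div (Nat.sub x y) 4)) B) 1)

/-- Like `nearBool`, also trying the reflection `1020 - y` of `y`. -/
def linkBool (A B x y : ℕ) : Bool :=
  cond (nearBool A B x y) true
    (cond (Nat.beq (Nat.mod (Nat.add x y) 8) 4) (nearBool A B x (Nat.sub 1020 y)) false)

def splitLinks (A B x : ℕ) (k : List ℕ → List ℕ → Bool) (l : List ℕ) :
    List ℕ → List ℕ → Bool :=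
  List.rec k
    (fun y _ ih st un => cond (linkBool A B x y) (ih (y :: st) un) (ih st (y :: un))) l

/-- Evaluates the numeral `n` before passing it to `k`. -/
def withNat (n : ℕ) (k : ℕ → Bool) : Bool := Nat.rec (k 0) (fun m _ => k (Nat.succ m)) n

/-- Graph search: `st` holds the reached vertices still to be processed and `un` the unreached
ones; the result is `true` if everything is reached within `n` steps. -/
def searchBool (D n : ℕ) : List ℕ → List ℕ → Bool :=
  Nat.rec (fun _ _ => false) (fun _ ih st un =>
    List.rec true (fun _ _ _ => List.rec false (fun x st _ =>
      withNat x fun x => withNat (shiftedDisc D x) fun A =>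
        withNat (shiftedDisc D (Nat.add x 4)) fun B => splitLinks A B x ih un st []) st) un) n

/-- The elements of `S̃_D` congruent to `c` modulo `8`, shifted by `512`. -/
def chainList (r c : ℕ) : List ℕ :=
  List.range' (512 - r + (c + r) % 8) ((516 + r - (512 - r + (c + r) % 8)) / 8) 8

/-- Whether the elements congruent to `c` modulo `8` are linked to each other. -/
def chainBool (D r c : ℕ) : Bool :=
  match chainList r c with
  | [] => true
  | x :: l => searchBool D 200 [x] l

theorem withNat_eq (n : ℕ) (k : ℕ → Bool) : withNat n k = k n := by
  cases n <;> rfl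

theorem splitLinks_eq (A B x : ℕ) (k : List ℕ → List ℕ → Bool) (l st un : List ℕ) :
    splitLinks A B x k l st un = k ((l.filter (linkBool A B x)).reverse ++ st)
      ((l.filter fun y => !linkBool A B x y).reverse ++ un) := by
  induction l generalizing st un with
  | nil => rfl
  | cons y l ih =>
    change cond (linkBool A B x y) (splitLinks A B x k l (y :: st) un)
      (splitLinks A B x k l st (y :: un)) = _
    cases h : linkBool A B x y <;> simp [ih, h]

theorem searchBool_cons {D n x y : ℕ} {st un : List ℕ} :
    searchBool D (n + 1) (x :: st) (y :: un) =
      splitLinks (shiftedDisc D x) (shiftedDisc D (x + 4)) x (searchBool D n) (y :: un) st [] := by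
  change withNat x (fun x => withNat (shiftedDisc D x) fun A =>
    withNat (shiftedDisc D (x + 4)) fun B =>
      splitLinks A B x (searchBool D n) (y :: un) st []) = _
  simp only [withNat_eq]

theorem cast_shiftedDisc {D x : ℕ} {e : ℤ} (hx : (x : ℤ) = e + 512) (he : e ^ 2 < D) :
    (shiftedDisc D x : ℤ) = D - e ^ 2 := by
  have h : shiftedDisc D x = D + 1024 * x - (x * x + 262144) := rfl
  rw [h]
  have hxx : (x : ℤ) * x = e ^ 2 + 1024 * e + 262144 := by rw [hx]; ring
  have hle : x * x + 262144 ≤ D + 1024 * x := by zify; linarith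
  rw [Nat.cast_sub hle]
  push_cast
  linarith

theorem gcd_disc_div_four {D n A : ℕ} {e : ℤ} (hD : (D : ℤ) % 4 = 0 ∨ (D : ℤ) % 4 = 1)
    (he : e ∈ SDt D) (hA : (A : ℤ) = D - e ^ 2) (h : Nat.gcd n A = 1) :
    Int.gcd n ((D - e ^ 2) / 4) = 1 := by
  rw [← Int.isCoprime_iff_gcd_eq_one]
  refine IsCoprime.of_isCoprime_of_dvd_right (Nat.isCoprime_iff_coprime.2 h) ?_
  rw [hA]
  exact ⟨4, (Int.ediv_mul_cancel (four_dvd_sub_sq hD he.1)).symm⟩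

section Search

variable {D : ℕ} (hD : (D : ℤ) % 4 = 0 ∨ (D : ℤ) % 4 = 1)

include hD

theorem linked_of_nearBool {x y : ℕ} (hx : (x : ℤ) - 512 ∈ SDt D) (hy : (y : ℤ) - 512 ∈ SDt D)
    (hxy : (4 : ℤ) ∣ y - x)
    (h : nearBool (shiftedDisc D x) (shiftedDisc D (x + 4)) x y = true) :
    Linked D ((x : ℤ) - 512) ((y : ℤ) - 512) := by
  unfold nearBool at h
  rcases le_or_gt x y with hle | hlt
  · rw [Nat.ble_eq_true_of_le hle, cond_true] at h
    have hg := gcd_disc_div_four hD hx (cast_shiftedDisc (by ring) hx.2.1) (Nat.eq_of_beq_eq_true h)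
    have hq : (((y.sub x).div 4).succ : ℤ) = (y - x) / 4 + 1 := by
      change (((y - x) / 4 + 1 : ℕ) : ℤ) = _
      push_cast [hle]; rfl
    have heq : (y : ℤ) - 512 = (x : ℤ) - 512 + 4 * ((((y.sub x).div 4).succ : ℤ) - 1) := by
      rw [hq]; omega
    rw [heq] at hy ⊢
    exact linked_add hx hy (by positivity) hg
  · have hb : Nat.ble x y = false := by
      rw [← Bool.not_eq_true, Nat.ble_eq]; omega
    rw [hb, cond_false] at h
    have hx' := reflect_mem hx
    have hy' := reflect_mem hy
    have hB : (shiftedDisc D (x + 4) : ℤ) = D - (-4 - ((x : ℤ) - 512)) ^ 2 := by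
      rw [cast_shiftedDisc (e := (x : ℤ) - 512 + 4) (by push_cast; ring) hx.2.2]
      ring
    have hg := gcd_disc_div_four hD hx' hB (Nat.eq_of_beq_eq_true h)
    have hq : (((x.sub y).div 4).succ : ℤ) = (x - y) / 4 + 1 := by
      change (((x - y) / 4 + 1 : ℕ) : ℤ) = _
      push_cast [hlt.le]; rfl
    have heq : -4 - ((y : ℤ) - 512)
        = -4 - ((x : ℤ) - 512) + 4 * ((((x.sub y).div 4).succ : ℤ) - 1) := by
      rw [hq]; omega
    refine .of_reflect hx hy ?_
    rw [heq] at hy' ⊢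
    exact linked_add hx' hy' (by positivity) hg

theorem linked_of_linkBool {x y : ℕ} (hx : (x : ℤ) - 512 ∈ SDt D) (hy : (y : ℤ) - 512 ∈ SDt D)
    (hy1020 : y ≤ 1020) (hxy : x % 8 = y % 8)
    (h : linkBool (shiftedDisc D x) (shiftedDisc D (x + 4)) x y = true) :
    Linked D ((x : ℤ) - 512) ((y : ℤ) - 512) := by
  unfold linkBool at h
  cases h₁ : nearBool (shiftedDisc D x) (shiftedDisc D (x + 4)) x y with
  | true => exact linked_of_nearBool hD hx hy (by omega) h₁
  | false =>
    rw [h₁, cond_false] at h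
    cases h₂ : Nat.beq (Nat.mod (Nat.add x y) 8) 4 with
    | false => rw [h₂, cond_false] at h; exact absurd h Bool.false_ne_true
    | true =>
      rw [h₂, cond_true] at h
      have h₃ : (x + y) % 8 = 4 := Nat.eq_of_beq_eq_true h₂
      have hcast : ((Nat.sub 1020 y : ℕ) : ℤ) - 512 = -4 - ((y : ℤ) - 512) := by
        change (((1020 - y : ℕ) : ℤ)) - 512 = _
        omega
      have hy' := reflect_mem hy
      rw [← hcast] at hy'
      have := linked_of_nearBool hD hx hy' (by omega) h
      rw [hcast] at this
      exact this.trans _ _ _ ((linked_reflect hy).symm _ _)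

theorem linked_of_searchBool {n b c : ℕ} {st un : List ℕ}
    (hst : ∀ x ∈ st, (x : ℤ) - 512 ∈ SDt D ∧ x % 8 = c ∧
      Linked D ((b : ℤ) - 512) ((x : ℤ) - 512))
    (hun : ∀ y ∈ un, (y : ℤ) - 512 ∈ SDt D ∧ y % 8 = c ∧ y ≤ 1020)
    (h : searchBool D n st un = true) :
    ∀ y ∈ un, Linked D ((b : ℤ) - 512) ((y : ℤ) - 512) := by
  induction n generalizing st un with
  | zero => exact absurd h Bool.false_ne_true
  | succ n ih =>
    match un, st, h with
    | [], _, _ => simp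
    | _ :: _, [], h => exact absurd h Bool.false_ne_true
    | y :: un, x :: st, h =>
      rw [searchBool_cons, splitLinks_eq] at h
      obtain ⟨hx, hxc, hbx⟩ := hst x (by simp)
      set p := linkBool (shiftedDisc D x) (shiftedDisc D (x + 4)) x
      have hreach : ∀ z ∈ y :: un, p z = true → Linked D ((b : ℤ) - 512) ((z : ℤ) - 512) := by
        intro z hz hpz
        obtain ⟨h1, h2, h3⟩ := hun z hz
        exact hbx.trans _ _ _ (linked_of_linkBool hD hx h1 h3 (hxc.trans h2.symm) hpz)
      have hrest := ih ?_ ?_ h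
      · intro z hz
        cases hpz : p z with
        | true => exact hreach z hz hpz
        | false =>
          refine hrest z ?_
          rw [List.append_nil, List.mem_reverse, List.mem_filter]
          exact ⟨hz, by simp [hpz]⟩
      · intro z hz
        rw [List.mem_append, List.mem_reverse, List.mem_filter] at hz
        rcases hz with ⟨hz, hpz⟩ | hz
        · exact ⟨(hun z hz).1, (hun z hz).2.1, hreach z hz hpz⟩
        · exact hst z (by simp [hz])
      · intro z hz
        rw [List.append_nil, List.mem_reverse, List.mem_filter] at hz
        exact hun z hz.1

theorem linked_of_chainBool {r c : ℕ} (hr : r ≤ 500) (hr2 : 2 ≤ r) (h₁ : r ^ 2 < D)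
    (h₂ : D ≤ (r + 1) ^ 2) (hc : (c : ℤ) % 2 = D % 2) (h : chainBool D r c = true)
    {e f : ℤ} (he : e ∈ SDt D) (hf : f ∈ SDt D) (hec : e % 8 = c) (hfc : f % 8 = c) : Linked D e f := by
  have mem : ∀ x : ℤ, x ∈ SDt D ↔ _ := fun x => mem_SDt_iff (e := x) (r := r) (by positivity)
    (by exact_mod_cast h₁) (by exact_mod_cast h₂)
  have hsound : ∀ x ∈ chainList r c, (x : ℤ) - 512 ∈ SDt D ∧ x % 8 = c % 8 ∧ x ≤ 1020 := by
    intro x hx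
    rw [chainList, List.mem_range'] at hx
    obtain ⟨i, hi, rfl⟩ := hx
    rw [mem]
    omega
  have hcomplete : ∀ g ∈ SDt D, g % 8 = c → ∃ x ∈ chainList r c, (x : ℤ) - 512 = g := by
    intro g hg hgc
    rw [mem] at hg
    refine ⟨(g + 512).toNat, ?_, by omega⟩
    rw [chainList, List.mem_range']
    refine ⟨((g + 512).toNat - (512 - r + (c + r) % 8)) / 8, ?_, ?_⟩ <;> omega
  obtain ⟨x, hx, rfl⟩ := hcomplete e he hec
  obtain ⟨y, hy, rfl⟩ := hcomplete f hf hfc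
  rw [chainBool] at h
  rcases hl : chainList r c with _ | ⟨b, l⟩
  · simp [hl] at hx
  rw [hl] at hx hy h hsound
  have hb := hsound b (by simp)
  have hlink := linked_of_searchBool hD (b := b) (c := c % 8)
    (by simpa using ⟨hb.1, hb.2.1, Relation.EqvGen.refl _⟩)
    (fun y hy => hsound y (by simp [hy])) h
  have hall : ∀ z ∈ b :: l, Linked D ((b : ℤ) - 512) ((z : ℤ) - 512) := by
    intro z hz
    rcases List.mem_cons.1 hz with rfl | hz
    · exact .refl _
    · exact hlink z hz
  exact ((hall x hx).symm _ _).trans _ _ _ (hall y hy)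

end Search

/-- Euler's criterion for `D` being a nonresidue modulo the prime `p = 2m + 1`, for `D > b`. -/
def nonresBool (D b p m : ℕ) : Bool :=
  cond (Nat.ble D b) false (Nat.beq (Nat.mod (Nat.pow D m) p) (Nat.pred p))

/-- `chainBool` for the classes modulo `8`, up to reflection, on which `(D - e ^ 2) / 4` is even. -/
def classBool (D r : ℕ) : Bool :=
  cond (Nat.beq (Nat.mod D 8) 0) (chainBool D r 0) <|
  cond (Nat.beq (Nat.mod D 8) 1) (chainBool D r 1 && chainBool D r 5) <|
  (chainBool D r 2 && chainBool D r 6)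

def exceptions : List ℕ :=
  [12, 16, 17, 20, 25, 28, 36, 73, 88, 97, 105, 112, 121, 124, 136,
    145, 148, 169, 172, 184, 193, 196, 201, 217, 220, 241, 244, 265, 268, 292,
    304, 316, 364, 385, 436, 484, 556, 604, 676, 796, 844, 1684]

/-- Whether `D` is a nonresidue modulo a prime `p ≡ 5 (mod 6)` with `(6 * p) ^ 2 < D`. -/
def jumpBool (D : ℕ) : Bool :=
  cond (nonresBool D 900 5 2) true <|
  cond (nonresBool D 4356 11 5) true <|
  cond (nonresBool D 10404 17 8) true <|
  cond (nonresBool D 19044 23 11) true <|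
  cond (nonresBool D 30276 29 14) true <|
  nonresBool D 60516 41 20

def heavyBool (r D : ℕ) : Bool :=
  cond (jumpBool D) true <| classBool D r || exceptions.elem D

/-- A sufficient criterion for the classes to be connected when `r ^ 2 < D ≤ (r + 1) ^ 2`, which also
accepts exceptional and irrelevant `D`. -/
def discBool (r D : ℕ) : Bool :=
  cond (Nat.beq (Nat.mod D 3) 2) true <|
  cond (Nat.beq (Nat.mod D 8) 5) true <|
  cond (Nat.ble 2 (Nat.mod D 4)) true <| heavyBool r D

/-- Checks `D = r * r + j + 1` for all `j < n`. -/
def rowBool (r n : ℕ) : Bool :=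
  Nat.rec true (fun j ih =>
    cond (withNat (Nat.add (Nat.mul r r) (Nat.succ j)) (discBool r)) ih false) n

/-- Checks all `D` with `9 < D ≤ (n + 3) ^ 2`. -/
def allBool (n : ℕ) : Bool :=
  Nat.rec true (fun n ih => cond (rowBool (Nat.add n 3) (Nat.add (Nat.mul 2 n) 7)) ih false) n

theorem allBool_eq_true : allBool 279 = true := by decide +kernel

theorem rowBool_apply {r n : ℕ} (h : rowBool r n = true) :
    ∀ j < n, discBool r (r * r + (j + 1)) = true := by
  induction n with
  | zero => simp
  | succ n ih =>
    change cond (withNat (r * r + (n + 1)) (discBool r)) (rowBool r n) false = true at h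
    rw [withNat_eq, Bool.cond_false_right, Bool.and_eq_true] at h
    intro j hj
    rcases Nat.lt_succ_iff_lt_or_eq.1 hj with hj | rfl
    · exact ih h.2 j hj
    · exact h.1

theorem allBool_apply {n : ℕ} (h : allBool n = true) :
    ∀ k < n, rowBool (k + 3) (2 * k + 7) = true := by
  induction n with
  | zero => simp
  | succ n ih =>
    change cond (rowBool (n + 3) (2 * n + 7)) (allBool n) false = true at h
    rw [Bool.cond_false_right, Bool.and_eq_true] at h
    intro j hj
    rcases Nat.lt_succ_iff_lt_or_eq.1 hj with hj | rfl
    · exact ih h.2 j hj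
    · exact h.1

theorem discBool_eq_true {D r : ℕ} (hr : 3 ≤ r) (hr' : r ≤ 281) (h₁ : r ^ 2 < D)
    (h₂ : D ≤ (r + 1) ^ 2) : discBool r D = true := by
  have h := allBool_apply allBool_eq_true (r - 3) (by omega)
  rw [show r - 3 + 3 = r by omega, show 2 * (r - 3) + 7 = 2 * r + 1 by omega] at h
  have hsq : (r + 1) ^ 2 = r * r + (2 * r + 1) := by ring
  rw [pow_two] at h₁
  have := rowBool_apply h (D - r * r - 1) (by omega)
  rwa [show r * r + (D - r * r - 1 + 1) = D by omega] at this

theorem hasJumps_of_nonresBool {D r b p m : ℕ} (hD : (D : ℤ) % 4 = 0 ∨ (D : ℤ) % 4 = 1)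
    (h₂ : D ≤ (r + 1) ^ 2) (hp : p.Prime) (hpm : p = 2 * m + 1) (hp6 : p % 6 = 5)
    (hb : b = (6 * p) ^ 2) (h : nonresBool D b p m = true) : HasJumps D r := by
  rw [nonresBool, Bool.cond_false_left, Bool.and_eq_true, Bool.not_eq_true',
    ← Bool.not_eq_true, Nat.ble_eq, not_le] at h
  refine hasJumps_of_nonresidue hD hp hpm hp6 ?_ ?_
  · have := lt_of_pow_lt_pow_left₀ 2 (by positivity) (hb ▸ h.1.trans_le h₂)
    omega
  · have h3 : D ^ m % p = p - 1 := Nat.eq_of_beq_eq_true h.2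
    have := hp.one_le
    have h4 : ((D ^ m % p : ℕ) : ℤ) = ((p - 1 : ℕ) : ℤ) := by rw [h3]
    push_cast [this] at h4
    exact h4

theorem hasJumps_of_jumpBool {D r : ℕ} (hD : (D : ℤ) % 4 = 0 ∨ (D : ℤ) % 4 = 1)
    (h₂ : D ≤ (r + 1) ^ 2) (h : jumpBool D = true) : HasJumps D r := by
  simp only [jumpBool, Bool.cond_true_left, Bool.or_eq_true] at h
  rcases h with h | h | h | h | h | h <;>
    exact hasJumps_of_nonresBool hD h₂ (by norm_num) (by norm_num) (by norm_num) (by norm_num) h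

theorem sq_emod_eight (e : ℤ) :
    e ^ 2 % 8 = if e % 2 = 1 then 1 else if e % 4 = 0 then 0 else 4 := by
  rcases (by omega : e % 8 = 0 ∨ e % 8 = 1 ∨ e % 8 = 2 ∨ e % 8 = 3 ∨ e % 8 = 4 ∨ e % 8 = 5 ∨
    e % 8 = 6 ∨ e % 8 = 7) with h | h | h | h | h | h | h | h <;>
    rw [pow_two, Int.mul_emod, h] <;> split_ifs <;> omega

theorem linked_of_classBool {D r : ℕ} (hD : (D : ℤ) % 4 = 0 ∨ (D : ℤ) % 4 = 1)
    (hr : r ≤ 500) (hr2 : 2 ≤ r) (h₁ : r ^ 2 < D) (h₂ : D ≤ (r + 1) ^ 2)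
    (h : classBool D r = true) {e f : ℤ} (he : e ∈ SDt D) (hf : f ∈ SDt D)
    (h₈ : 8 ∣ D - e ^ 2) (hef : e % 8 = f % 8) : Linked D e f := by
  have chain : ∀ c : ℕ, (c : ℤ) % 2 = (D : ℤ) % 2 → chainBool D r c = true →
      e % 8 = c ∨ (-4 - e) % 8 = c → Linked D e f := by
    rintro c hc hbool (hec | hec)
    · exact linked_of_chainBool hD hr hr2 h₁ h₂ hc hbool he hf hec (hef ▸ hec)
    · exact .of_reflect he hf (linked_of_chainBool hD hr hr2 h₁ h₂ hc hbool (reflect_mem he)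
        (reflect_mem hf) hec (by omega))
  have hpar := he.1
  have hsq := sq_emod_eight e
  rcases (by split_ifs at hsq <;> omega : D % 8 = 0 ∨ D % 8 = 1 ∨ D % 8 = 4) with h' | h' | h'
  · rw [classBool, show Nat.mod D 8 = 0 from h'] at h
    exact chain 0 (by omega) h (by split_ifs at hsq <;> omega)
  · rw [classBool, show Nat.mod D 8 = 1 from h'] at h
    obtain ⟨ha, hb⟩ := Bool.and_eq_true_iff.1 h
    rcases (by omega : (e % 8 = 1 ∨ e % 8 = 3) ∨ (e % 8 = 5 ∨ e % 8 = 7)) with h8 | h8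
    · exact chain 1 (by omega) ha (by omega)
    · exact chain 5 (by omega) hb (by omega)
  · rw [classBool, show Nat.mod D 8 = 4 from h'] at h
    obtain ⟨ha, hb⟩ := Bool.and_eq_true_iff.1 h
    rcases (by split_ifs at hsq <;> omega : e % 8 = 2 ∨ e % 8 = 6) with h8 | h8
    · exact chain 2 (by omega) ha (by omega)
    · exact chain 6 (by omega) hb (by omega)

theorem exists_sq_lt_le {D : ℤ} (hD : 0 < D) :
    ∃ r : ℕ, (r : ℤ) ^ 2 < D ∧ D ≤ ((r : ℤ) + 1) ^ 2 := by
  lift D to ℕ using hD.le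
  have h₁ := Nat.sqrt_le' (D - 1)
  have h₂ := Nat.lt_succ_sqrt' (D - 1)
  refine ⟨Nat.sqrt (D - 1), ?_, ?_⟩
  · exact_mod_cast (by omega : Nat.sqrt (D - 1) ^ 2 < D)
  · exact_mod_cast (by rw [Nat.succ_eq_add_one] at h₂; omega : D ≤ (Nat.sqrt (D - 1) + 1) ^ 2)

theorem linked_of_eight_dvd {D : ℕ} (h12 : 12 ≤ D) (hD : (D : ℤ) % 4 = 0 ∨ (D : ℤ) % 4 = 1)
    (hexc : D ∉ exceptions) {e f : ℤ} (he : e ∈ SDt D) (hf : f ∈ SDt D) (h₈ : 8 ∣ D - e ^ 2)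
    (hef : e % 8 = f % 8) : Linked D e f := by
  obtain ⟨r, h₁, h₂⟩ := exists_sq_lt_le (D := D) (by omega)
  have hr : (0 : ℤ) ≤ r := by positivity
  by_cases H : (D : ℤ) % 3 = 2 ∨ HasJumps D r
  · exact linked_of_steps hr h₁ h₂ (d := 8) (by norm_num) (by norm_num) (P := fun _ => True)
      (fun _ _ => trivial)
      (fun x hx hx' _ => linked_add_eight_of_hasJumps hD hr h₁ h₂ H hx hx')
      he hf trivial trivial (by omega)
  push Not at H
  have hsmall : D ≤ 79524 := by
    by_contra! hlt
    exact H.2 (hasJumps_of_large hr h₂ hD (by exact_mod_cast hlt))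
  have h₁' : r ^ 2 < D := by exact_mod_cast h₁
  have h₂' : D ≤ (r + 1) ^ 2 := by exact_mod_cast h₂
  have hr3 : 3 ≤ r := by by_contra! hlt; nlinarith
  have hr' : r ≤ 281 := by by_contra! hlt; nlinarith
  have h5 : D % 8 ≠ 5 := by
    intro h5
    have hpar := he.1
    have hsq := sq_emod_eight e
    split_ifs at hsq <;> omega
  have h := discBool_eq_true hr3 hr' h₁' h₂'
  simp only [discBool, heavyBool, Bool.cond_true_left, Bool.or_eq_true, Nat.beq_eq, Nat.ble_eq,
    List.elem_iff] at h
  rcases h with h | h | h | h | h | h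
  · exact absurd (by exact_mod_cast h : (D : ℤ) % 3 = 2) H.1
  · exact absurd h h5
  · change 2 ≤ D % 4 at h
    omega
  · exact absurd (hasJumps_of_jumpBool hD h₂' h) H.2
  · exact linked_of_classBool hD (by omega) (by omega) h₁' h₂' h he hf h₈ hef
  · exact absurd h hexc

theorem linked_of_emod_four_eq {D : ℤ} (hD : 0 < D) {P : ℤ → Prop} (hP : ∀ x, P x → P (x + 4))
    (hodd : ∀ x ∈ SDt D, P x → (D - x ^ 2) % 8 = 4) {e f : ℤ} (he : e ∈ SDt D)
    (hf : f ∈ SDt D) (hPe : P e) (hPf : P f) (hef : 4 ∣ f - e) : Linked D e f := by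
  obtain ⟨r, h₁, h₂⟩ := exists_sq_lt_le hD
  exact linked_of_steps (by positivity) h₁ h₂ (d := 4) (by norm_num) (by norm_num) hP
    (fun x hx hx' hPx => linked_add_four hx hx' (hodd x hx hPx)) he hf hPe hPf hef

theorem SMoveT.emod_four {D e f : ℤ} (h : SMoveT D e f) : f % 4 = -e % 4 := by
  obtain ⟨-, -, q, -, rfl, -⟩ := h
  omega

theorem SMoveT.emod_eight {D e f : ℤ} (h : SMoveT D e f) (h₈ : 8 ∣ D - e ^ 2) :
    f % 8 = (-e - 4) % 8 := by
  obtain ⟨-, -, q, -, rfl, hq⟩ := h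
  have : ¬ 2 ∣ q := by
    intro h2
    have := Int.dvd_coe_gcd h2 (by omega : 2 ∣ (D - e ^ 2) / 4)
    omega
  omega

theorem Linked.iff_of_move {D : ℤ} {P : ℤ → Prop} (hP : ∀ e f, SMoveT D e f → (P e ↔ P f))
    {e f : ℤ} (h : Linked D e f) : P e ↔ P f := by
  induction h with
  | rel _ _ h => exact hP _ _ h
  | refl => exact Iff.rfl
  | symm _ _ _ ih => exact ih.symm
  | trans _ _ _ _ _ ih ih' => exact ih.trans ih'

section Components

variable {D : ℤ} (h12 : 12 ≤ D) {e f : ℤ} (he : e ∈ SDt D) (hf : f ∈ SDt D)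

include h12 he hf

theorem linked_of_eight_dvd_of_reflect (hexc : D.toNat ∉ exceptions) (h₈ : 8 ∣ D - e ^ 2)
    (hef : e % 8 = f % 8 ∨ (-4 - e) % 8 = f % 8) : Linked D e f := by
  have hD : D % 4 = 0 ∨ D % 4 = 1 := by
    have hsq := sq_emod_eight e
    split_ifs at hsq <;> omega
  have same : ∀ x ∈ SDt D, 8 ∣ D - x ^ 2 → x % 8 = f % 8 → Linked D x f := by
    intro x hx
    lift D to ℕ using (by omega)
    exact linked_of_eight_dvd (by omega) hD hexc hx hf
  rcases hef with h | h
  · exact same e he h₈ h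
  · refine (linked_reflect he).trans _ _ _ (same _ (reflect_mem he) ?_ h)
    rw [show D - (-4 - e) ^ 2 = D - e ^ 2 - 8 * (e + 2) by ring]
    omega

theorem linked_iff_of_emod_eight_eq_zero (hexc : D.toNat ∉ exceptions) (h : D % 8 = 0) :
    Linked D e f ↔ ((e % 8 = 0 ∨ e % 8 = 4) ∧ (f % 8 = 0 ∨ f % 8 = 4)) ∨
      ((e % 8 = 2 ∨ e % 8 = 6) ∧ (f % 8 = 2 ∨ f % 8 = 6)) := by
  have hpe := he.1
  have hpf := hf.1
  constructor
  · intro hl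
    have i4 : e % 4 = 0 ↔ f % 4 = 0 :=
      hl.iff_of_move (P := fun x => x % 4 = 0) fun x y hxy => by have := hxy.emod_four; omega
    omega
  · rintro (hc | hc)
    · refine linked_of_eight_dvd_of_reflect h12 he hf hexc ?_ (by omega)
      have hsq := sq_emod_eight e
      split_ifs at hsq <;> omega
    · refine linked_of_emod_four_eq (by omega) (P := fun x => x % 4 = 2) (fun x hx => by omega)
        (fun x _ hx4 => ?_) he hf (by omega) (by omega) (by omega)
      have hsq := sq_emod_eight x
      split_ifs at hsq <;> omega

theorem linked_iff_of_emod_eight_eq_one (hexc : D.toNat ∉ exceptions) (h : D % 8 = 1) :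
    Linked D e f ↔ ((e % 8 = 1 ∨ e % 8 = 3) ∧ (f % 8 = 1 ∨ f % 8 = 3)) ∨
      ((e % 8 = 7 ∨ e % 8 = 5) ∧ (f % 8 = 7 ∨ f % 8 = 5)) := by
  have hpe := he.1
  have hpf := hf.1
  have hdvd : ∀ x ∈ SDt D, 8 ∣ D - x ^ 2 := by
    intro x hx
    have hsq := sq_emod_eight x
    have hpx := hx.1
    split_ifs at hsq <;> omega
  constructor
  · intro hl
    have i8 : (e % 8 = 1 ∨ e % 8 = 3) ↔ (f % 8 = 1 ∨ f % 8 = 3) := by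
      refine hl.iff_of_move (P := fun x => x % 8 = 1 ∨ x % 8 = 3) fun x y hxy => ?_
      have hxy8 := hxy.emod_eight (hdvd x hxy.1)
      omega
    omega
  · intro hc
    exact linked_of_eight_dvd_of_reflect h12 he hf hexc (hdvd e he) (by omega)

theorem linked_iff_of_emod_eight_eq_four (hexc : D.toNat ∉ exceptions) (h : D % 8 = 4) :
    Linked D e f ↔ ((e % 8 = 0 ∨ e % 8 = 4) ∧ (f % 8 = 0 ∨ f % 8 = 4)) ∨
      (e % 8 = 2 ∧ f % 8 = 2) ∨ (e % 8 = 6 ∧ f % 8 = 6) := by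
  have hpe := he.1
  have hpf := hf.1
  have hdvd : ∀ x : ℤ, x % 4 = 2 → 8 ∣ D - x ^ 2 := by
    intro x hx
    have hsq := sq_emod_eight x
    split_ifs at hsq <;> omega
  constructor
  · intro hl
    have i4 : e % 4 = 0 ↔ f % 4 = 0 :=
      hl.iff_of_move (P := fun x => x % 4 = 0) fun x y hxy => by have := hxy.emod_four; omega
    have i8 : e % 8 = 2 ↔ f % 8 = 2 := by
      refine hl.iff_of_move (P := fun x => x % 8 = 2) fun x y hxy => ?_
      have hxy4 := hxy.emod_four
      by_cases hx : x % 4 = 2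
      · have hxy8 := hxy.emod_eight (hdvd x hx)
        omega
      · omega
    omega
  · rintro (hc | hc)
    · refine linked_of_emod_four_eq (by omega) (P := fun x => x % 4 = 0) (fun x hx => by omega)
        (fun x _ hx4 => ?_) he hf (by omega) (by omega) (by omega)
      have hsq := sq_emod_eight x
      split_ifs at hsq <;> omega
    · exact linked_of_eight_dvd_of_reflect h12 he hf hexc (hdvd e (by omega)) (by omega)

theorem linked_of_emod_eight_eq_five (h : D % 8 = 5) : Linked D e f := by
  have hpe := he.1
  have hpf := hf.1
  have step : ∀ x ∈ SDt D, 4 ∣ f - x → Linked D x f := by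
    intro x hx hxf
    refine linked_of_emod_four_eq (by omega) (P := fun y => y % 2 = 1) (fun y hy => by omega)
      (fun y _ hy => ?_) hx hf (by omega) (by omega) hxf
    have hsq := sq_emod_eight y
    split_ifs at hsq; omega
  rcases (by omega : 4 ∣ f - e ∨ 4 ∣ f - (-4 - e)) with h4 | h4
  · exact step e he h4
  · exact (linked_reflect he).trans _ _ _ (step _ (reflect_mem he) h4)

end Components

/-- Component count of `S̃_D` for `D ≥ 12`, `D ≡ 0, 1 (mod 4)`, `D` outside the
exceptional list: three components when `D ≡ 4 (mod 8)`, two components when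
`D ≡ 1 (mod 8)` or `D ≡ 0 (mod 8)`, one component otherwise (`D ≡ 5 (mod 8)`). -/
theorem stmt18 (D : ℤ) (hD : 12 ≤ D) (hmod : D % 4 = 0 ∨ D % 4 = 1)
    (hexc : D ∉ ({12, 16, 17, 20, 25, 28, 36, 73, 88, 97, 105, 112, 121, 124, 136,
      145, 148, 169, 172, 184, 193, 196, 201, 217, 220, 241, 244, 265, 268, 292,
      304, 316, 364, 385, 436, 484, 556, 604, 676, 796, 844, 1684} : Set ℤ)) :
    (SDt D).Nonempty ∧
    (D % 8 = 4 →
      (∃ e ∈ SDt D, e % 8 = 0 ∨ e % 8 = 4) ∧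
      (∃ e ∈ SDt D, e % 8 = 2) ∧
      (∃ e ∈ SDt D, e % 8 = 6) ∧
      (∀ e ∈ SDt D, ∀ e' ∈ SDt D,
        (Relation.EqvGen (SMoveT D) e e' ↔
          (((e % 8 = 0 ∨ e % 8 = 4) ∧ (e' % 8 = 0 ∨ e' % 8 = 4)) ∨
           (e % 8 = 2 ∧ e' % 8 = 2) ∨
           (e % 8 = 6 ∧ e' % 8 = 6))))) ∧
    (D % 8 = 1 →
      (∃ e ∈ SDt D, e % 8 = 1 ∨ e % 8 = 3) ∧
      (∃ e ∈ SDt D, e % 8 = 7 ∨ e % 8 = 5) ∧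
      (∀ e ∈ SDt D, ∀ e' ∈ SDt D,
        (Relation.EqvGen (SMoveT D) e e' ↔
          (((e % 8 = 1 ∨ e % 8 = 3) ∧ (e' % 8 = 1 ∨ e' % 8 = 3)) ∨
           ((e % 8 = 7 ∨ e % 8 = 5) ∧ (e' % 8 = 7 ∨ e' % 8 = 5)))))) ∧
    (D % 8 = 0 →
      (∃ e ∈ SDt D, e % 8 = 0 ∨ e % 8 = 4) ∧
      (∃ e ∈ SDt D, e % 8 = 2 ∨ e % 8 = 6) ∧
      (∀ e ∈ SDt D, ∀ e' ∈ SDt D,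
        (Relation.EqvGen (SMoveT D) e e' ↔
          (((e % 8 = 0 ∨ e % 8 = 4) ∧ (e' % 8 = 0 ∨ e' % 8 = 4)) ∨
           ((e % 8 = 2 ∨ e % 8 = 6) ∧ (e' % 8 = 2 ∨ e' % 8 = 6)))))) ∧
    (D % 8 = 5 →
      ∀ e ∈ SDt D, ∀ e' ∈ SDt D, Relation.EqvGen (SMoveT D) e e') := by
  have hexc' : D.toNat ∉ exceptions := by
    intro h
    refine hexc ?_
    lift D to ℕ using (by omega)
    rw [Int.toNat_natCast] at h
    simp only [exceptions, List.mem_cons, List.not_mem_nil, or_false] at h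
    simp only [Set.mem_insert_iff, Set.mem_singleton_iff]
    exact_mod_cast h
  have h₀ : D % 8 = 0 → 16 < D := by
    intro h
    by_contra! hle
    obtain rfl : D = 16 := by omega
    exact hexc (by simp)
  have h₁ : D % 8 = 1 → 25 < D := by
    intro h
    by_contra! hle
    obtain rfl | rfl : D = 17 ∨ D = 25 := by omega
    all_goals exact hexc (by simp)
  have h₄ : D % 8 = 4 → 36 < D := by
    intro h
    by_contra! hle
    obtain rfl | rfl | rfl | rfl : D = 12 ∨ D = 20 ∨ D = 28 ∨ D = 36 := by omega
    all_goals exact hexc (by simp)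
  clear hexc
  refine ⟨?_, fun h => ?_, fun h => ?_, fun h => ?_, fun h => ?_⟩
  · rcases hmod with h | h
    · exact ⟨-2, by omega, by omega, by omega⟩
    · exact ⟨-1, by omega, by omega, by omega⟩
  · exact ⟨⟨0, ⟨by omega, by omega, by omega⟩, by omega⟩,
      ⟨-6, ⟨by omega, by omega, by omega⟩, by omega⟩,
      ⟨-2, ⟨by omega, by omega, by omega⟩, by omega⟩,
      fun e he f hf => linked_iff_of_emod_eight_eq_four hD he hf hexc' h⟩
  · exact ⟨⟨-5, ⟨by omega, by omega, by omega⟩, by omega⟩,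
      ⟨-3, ⟨by omega, by omega, by omega⟩, by omega⟩,
      fun e he f hf => linked_iff_of_emod_eight_eq_one hD he hf hexc' h⟩
  · exact ⟨⟨0, ⟨by omega, by omega, by omega⟩, by omega⟩,
      ⟨-2, ⟨by omega, by omega, by omega⟩, by omega⟩,
      fun e he f hf => linked_iff_of_emod_eight_eq_zero hD he hf hexc' h⟩
  · exact fun e he f hf => linked_of_emod_eight_eq_five hD he hf h
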